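/- Let G_0, …, G_n ∈ Mat_N(ℂ[x]) with deg G_j ≤ j for every j, and suppose the operator 𝔇 : P ↦ Σ_{j=0}^n P^{(j)} G_j is W_H-symmetric, i.e. ∫_ℝ (P·𝔇)(x) W_H(x) Q(x)^* dx = ∫_ℝ P(x) W_H(x) ((Q·𝔇)(x))^* dx for all P, Q ∈ Mat_N(ℂ[x]). Then there exist diagonal matrix polynomials F_0, …, F_n ∈ Mat_N(ℂ[x]) with deg F_j ≤ j such that G_n(x) = F_n(x) + x(AF_n(x) − F_n(x)A), and G_j(x) = F_j(x) + x(AF_j(x) − F_j(x)A) + (j+1)A F_{j+1}(x) for 0 ≤ j ≤ n−1; moreover the operator P ↦ Σ_{j=0}^n P^{(j)} F_j is W̃_H-symmetric, where W̃_H(x) = diag(e^{−x²+2b_1x}, …, e^{−x²+2b_Nx}). (This expresses the inclusion D(W_H) ⊆ T(x)·D(W̃_H)·T(x)^{−1} at the level of symmetric operators.) -/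

import Mathlib

open Polynomial MeasureTheory Matrix

noncomputable section

abbrev Mat (N : ℕ) := Matrix (Fin N) (Fin N) ℂ

/-- The matrix unit with a `1` in the (1-indexed) entry `(s, t)` and `0` elsewhere. -/
def EU (N : ℕ) (s t : ℕ) : Mat N :=
  Matrix.of fun p q => if (p : ℕ) + 1 = s ∧ (q : ℕ) + 1 = t then 1 else 0

/-- Evaluation of a matrix polynomial at a real point. -/
def mval {N : ℕ} (P : Polynomial (Mat N)) (x : ℝ) : Mat N :=
  Polynomial.eval ((x : ℂ) • (1 : Mat N)) P

/-- The nilpotent matrix `A = Σ a_{2j-1} E_{2j-1,2j} + Σ a_{2j} E_{2j+1,2j}`. -/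
def Amat (N : ℕ) (a : ℕ → ℝ) : Mat N :=
  (∑ j ∈ Finset.Icc 1 (N / 2), (a (2 * j - 1) : ℂ) • EU N (2 * j - 1) (2 * j)) +
  (∑ j ∈ Finset.Icc 1 ((N - 1) / 2), (a (2 * j) : ℂ) • EU N (2 * j + 1) (2 * j))

/-- `K = Σ_{j=1}^{⌊N/2⌋} E_{2j,2j}`. -/
def Kmat (N : ℕ) : Mat N := ∑ j ∈ Finset.Icc 1 (N / 2), EU N (2 * j) (2 * j)

/-- `T(x) = I + x A`. -/
def Tmat (N : ℕ) (a : ℕ → ℝ) (x : ℝ) : Mat N := 1 + (x : ℂ) • Amat N a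

/-- The diagonal Hermite weight `diag(e^{-x²+2b₁x}, …, e^{-x²+2b_Nx})` (1-indexed `b`). -/
def hermiteDiag (N : ℕ) (b : ℕ → ℝ) (x : ℝ) : Mat N :=
  Matrix.diagonal fun i => (Real.exp (-x ^ 2 + 2 * b ((i : ℕ) + 1) * x) : ℂ)

/-- The Hermite-type weight `W_H(x) = T(x) · diag(…) · T(x)^*`. -/
def WH (N : ℕ) (a b : ℕ → ℝ) (x : ℝ) : Mat N :=
  Tmat N a x * hermiteDiag N b x * (Tmat N a x)ᴴ

/-- The right action `P·𝔇 = Σ_{j=0}^n P^{(j)} F_j` of a differential operator with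
matrix-polynomial coefficients `F_0, …, F_n`. -/
def applyOp {N : ℕ} (F : ℕ → Polynomial (Mat N)) (n : ℕ) (P : Polynomial (Mat N)) :
    Polynomial (Mat N) :=
  ∑ j ∈ Finset.range (n + 1), (fun Q : Polynomial (Mat N) => derivative Q)^[j] P * F j

/-- The integral of a complex polynomial against the scalar weight `e^{-x²+2cx}`. -/
def hermiteMoment (c : ℝ) (p : ℂ[X]) : ℂ :=
  ∫ x : ℝ, p.eval (x : ℂ) * (Real.exp (-x ^ 2 + 2 * c * x) : ℂ)

theorem integrable_eval_mul_exp_neg_sq (p : ℂ[X]) :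
    Integrable fun x : ℝ => p.eval (x : ℂ) * (Real.exp (-x ^ 2) : ℂ) := by
  induction p using Polynomial.induction_on' with
  | add p q hp hq => 
    refine (hp.add hq).congr (Filter.Eventually.of_forall fun x => ?_)
    simp [add_mul]
  | monomial m r =>
    have h := (integrable_rpow_mul_exp_neg_mul_sq one_pos (s := (m : ℝ))
      (by linarith [m.cast_nonneg (α := ℝ)])).ofReal (𝕜 := ℂ)
    refine (h.const_mul r).congr (Filter.Eventually.of_forall fun x => ?_)
    simp [Real.rpow_natCast, mul_assoc]

theorem integrable_eval_mul_hermite (c : ℝ) (p : ℂ[X]) :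
    Integrable fun x : ℝ => p.eval (x : ℂ) * (Real.exp (-x ^ 2 + 2 * c * x) : ℂ) := by
  have h := ((integrable_eval_mul_exp_neg_sq (p.comp (X + C (c : ℂ)))).comp_sub_right c).mul_const
    (Real.exp (c ^ 2) : ℂ)
  refine h.congr (Filter.Eventually.of_forall fun x => ?_)
  have : Real.exp (-x ^ 2 + 2 * c * x) = Real.exp (-(x - c) ^ 2) * Real.exp (c ^ 2) := by
    rw [← Real.exp_add]; ring_nf
  simp only [this]
  simp [mul_assoc]

theorem hermiteMoment_add (c : ℝ) (p q : ℂ[X]) :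
    hermiteMoment c (p + q) = hermiteMoment c p + hermiteMoment c q := by
  rw [hermiteMoment, hermiteMoment, hermiteMoment, ← integral_add
    (integrable_eval_mul_hermite c p) (integrable_eval_mul_hermite c q)]
  simp [add_mul]

theorem hermiteMoment_zero (c : ℝ) : hermiteMoment c 0 = 0 := by simp [hermiteMoment]

theorem hermiteMoment_neg (c : ℝ) (p : ℂ[X]) :
    hermiteMoment c (-p) = -hermiteMoment c p := by
  have h := hermiteMoment_add c p (-p)
  rw [add_neg_cancel, hermiteMoment_zero] at h
  exact (neg_eq_of_add_eq_zero_right h.symm).symm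

theorem hermiteMoment_sub (c : ℝ) (p q : ℂ[X]) :
    hermiteMoment c (p - q) = hermiteMoment c p - hermiteMoment c q := by
  rw [sub_eq_add_neg, hermiteMoment_add, hermiteMoment_neg, sub_eq_add_neg]

theorem hermiteMoment_sum (c : ℝ) {ι : Type*} (s : Finset ι) (f : ι → ℂ[X]) :
    hermiteMoment c (∑ i ∈ s, f i) = ∑ i ∈ s, hermiteMoment c (f i) := by
  classical
  induction s using Finset.induction_on with
  | empty => simp [hermiteMoment_zero]
  | insert i s hi ih => rw [Finset.sum_insert hi, Finset.sum_insert hi, hermiteMoment_add, ih]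

/-- Integration by parts against the scalar weight. -/
theorem hermiteMoment_derivative (c : ℝ) (p : ℂ[X]) :
    hermiteMoment c (derivative p) = hermiteMoment c (C 2 * (X - C (c : ℂ)) * p) := by
  rw [← sub_eq_zero, ← hermiteMoment_sub, hermiteMoment]
  refine integral_eq_zero_of_hasDerivAt_of_integrable
    (f := fun x : ℝ => p.eval (x : ℂ) * (Real.exp (-x ^ 2 + 2 * c * x) : ℂ)) (fun x => ?_)
    (integrable_eval_mul_hermite c _) (integrable_eval_mul_hermite c p)
  have hp : HasDerivAt (fun y : ℝ => p.eval (y : ℂ)) ((derivative p).eval (x : ℂ)) x :=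
    (p.hasDerivAt (x : ℂ)).comp_ofReal
  have he : HasDerivAt (fun y : ℝ => Real.exp (-y ^ 2 + 2 * c * y))
      (Real.exp (-x ^ 2 + 2 * c * x) * (-(2 * x) + 2 * c)) x := by
    refine HasDerivAt.exp ?_
    refine (((hasDerivAt_pow 2 x).fun_neg).fun_add
      ((hasDerivAt_id' x).const_mul (2 * c))).congr_deriv ?_
    simp
  refine (hp.fun_mul he.ofReal_comp).congr_deriv ?_
  simp only [eval_sub, eval_mul, eval_C, eval_X]
  push_cast
  ring

/-- The polynomial whose values on the real line are conjugate to those of `p`. -/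
def conjPoly (p : ℂ[X]) : ℂ[X] := p.map (starRingEnd ℂ)

theorem eval_conjPoly (p : ℂ[X]) (x : ℝ) :
    (conjPoly p).eval (x : ℂ) = star (p.eval (x : ℂ)) := by
  rw [conjPoly, ← Complex.conj_ofReal x, eval_map_apply, Complex.conj_ofReal]
  rfl

theorem conjPoly_conjPoly (p : ℂ[X]) : conjPoly (conjPoly p) = p := by
  ext k; simp [conjPoly]

theorem eq_zero_of_hermiteMoment_mul_conjPoly (c : ℝ) {p : ℂ[X]}
    (h : hermiteMoment c (conjPoly p * p) = 0) : p = 0 := by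
  have key (x : ℝ) : (conjPoly p * p).eval (x : ℂ) * (Real.exp (-x ^ 2 + 2 * c * x) : ℂ)
      = ((Complex.normSq (p.eval (x : ℂ)) * Real.exp (-x ^ 2 + 2 * c * x) : ℝ) : ℂ) := by
    rw [eval_mul, eval_conjPoly, Complex.ofReal_mul, Complex.normSq_eq_conj_mul_self]; rfl
  have hint := integrable_eval_mul_hermite c (conjPoly p * p)
  rw [hermiteMoment] at h
  simp only [key] at h hint
  rw [integral_complex_ofReal, Complex.ofReal_eq_zero, integral_eq_zero_iff_of_nonneg
    (fun x => mul_nonneg (Complex.normSq_nonneg _) (Real.exp_pos _).le)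
    (by simpa only [RCLike.re_to_complex, Complex.ofReal_re] using hint.re)] at h
  have hc : Continuous fun x : ℝ =>
      Complex.normSq (p.eval (x : ℂ)) * Real.exp (-x ^ 2 + 2 * c * x) := by
    have := p.continuous
    have := Complex.continuous_normSq
    fun_prop
  have hz := (hc.ae_eq_iff_eq volume continuous_const).1 h
  refine Polynomial.eq_zero_of_infinite_isRoot p
    ((Set.infinite_range_of_injective Complex.ofReal_injective).mono ?_)
  rintro _ ⟨x, rfl⟩
  have hx : Complex.normSq (p.eval (x : ℂ)) * Real.exp (-x ^ 2 + 2 * c * x) = 0 := congrFun hz x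
  simpa only [mul_eq_zero, (Real.exp_pos _).ne', or_false, Complex.normSq_eq_zero,
    Set.mem_ofPred_eq, IsRoot.def] using hx

theorem eq_zero_of_forall_hermiteMoment_mul (c : ℝ) {p : ℂ[X]}
    (h : ∀ q, hermiteMoment c (q * p) = 0) : p = 0 :=
  eq_zero_of_hermiteMoment_mul_conjPoly c (h _)

/-- Two polynomial densities against scalar weights with distinct shifts which have the same
moments vanish: equating the Pearson equations of the common functional yields
`2 (c - d) u v = u v' - v u'`, which is impossible by degree unless `u v = 0`. -/
theorem eq_zero_of_hermiteMoment_eq {c d : ℝ} (hcd : c ≠ d) {u v : ℂ[X]}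
    (h : ∀ p, hermiteMoment c (p * u) = hermiteMoment d (p * v)) : u = 0 := by
  have pearson (e : ℝ) (w r : ℂ[X]) : hermiteMoment e (derivative r * w)
      = hermiteMoment e (C 2 * (X - C (e : ℂ)) * r * w - r * derivative w) := by
    rw [hermiteMoment_sub, mul_assoc _ r w, ← hermiteMoment_derivative, derivative_mul,
      hermiteMoment_add, add_sub_cancel_right]
  have huv : u * v = 0 := by
    have hw : u * (C (2 * (c - d) : ℂ) * (u * v) - (u * derivative v - v * derivative u)) = 0 := by
      refine eq_zero_of_forall_hermiteMoment_mul c fun p => ?_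
      have hc := pearson c u (p * (u * v))
      have hd := pearson d v (p * (u * v))
      rw [show C 2 * (X - C (c : ℂ)) * (p * (u * v)) * u - p * (u * v) * derivative u
        = (C 2 * (X - C (c : ℂ)) * (p * (u * v)) - p * v * derivative u) * u by ring] at hc
      rw [show C 2 * (X - C (d : ℂ)) * (p * (u * v)) * v - p * (u * v) * derivative v
        = (C 2 * (X - C (d : ℂ)) * (p * (u * v)) - p * u * derivative v) * v by ring,
        ← h, ← h, hc, ← sub_eq_zero, ← hermiteMoment_sub] at hd
      rw [← neg_eq_zero, ← hermiteMoment_neg, ← hd]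
      congr 1
      simp only [C_mul, C_sub]
      ring
    rcases mul_eq_zero.1 hw with hu | hw
    · simp [hu]
    by_contra hne
    have hu := left_ne_zero_of_mul hne
    have hv := right_ne_zero_of_mul hne
    have hlt : (u * derivative v - v * derivative u).degree < (u * v).degree := by
      refine (degree_sub_le _ _).trans_lt (max_lt ?_ ?_)
      · rw [degree_mul, degree_mul]
        exact WithBot.add_lt_add_left (degree_ne_bot.2 hu) (degree_derivative_lt hv)
      · rw [mul_comm u, degree_mul, degree_mul]
        exact WithBot.add_lt_add_left (degree_ne_bot.2 hv) (degree_derivative_lt hu)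
    rw [← sub_eq_zero.1 hw, degree_C_mul] at hlt
    · exact lt_irrefl _ hlt
    · simpa [sub_eq_zero] using hcd
  rcases mul_eq_zero.1 huv with hu | hv
  · exact hu
  · exact eq_zero_of_forall_hermiteMoment_mul c fun q => by
      rw [h, hv, mul_zero, hermiteMoment_zero]

/-- The scalar differential operator `p ↦ Σ_{j ≤ n} p^{(j)} h_j`. -/
def scalarOp (h : ℕ → ℂ[X]) (n : ℕ) (p : ℂ[X]) : ℂ[X] :=
  ∑ j ∈ Finset.range (n + 1), derivative^[j] p * h j

theorem hermiteMoment_iterate_derivative_mul (c : ℝ) (j : ℕ) (p f : ℂ[X]) :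
    hermiteMoment c (derivative^[j] p * f)
      = hermiteMoment c (p * (fun g => C 2 * (X - C (c : ℂ)) * g - derivative g)^[j] f) := by
  induction j generalizing f with
  | zero => rfl
  | succ j ih =>
    rw [Function.iterate_succ_apply', Function.iterate_succ_apply, ← ih, mul_sub,
      hermiteMoment_sub, mul_left_comm,
      ← hermiteMoment_derivative, derivative_mul, hermiteMoment_add, add_sub_cancel_right]

theorem exists_hermiteMoment_adjoint (c : ℝ) (h : ℕ → ℂ[X]) (n : ℕ) :
    ∃ R : ℂ[X] → ℂ[X], ∀ p q,
      hermiteMoment c (scalarOp h n p * q) = hermiteMoment c (p * R q) := by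
  refine ⟨fun q => ∑ j ∈ Finset.range (n + 1),
    (fun g => C 2 * (X - C (c : ℂ)) * g - derivative g)^[j] (h j * q), fun p q => ?_⟩
  simp only [scalarOp, Finset.sum_mul, Finset.mul_sum, hermiteMoment_sum,
    ← hermiteMoment_iterate_derivative_mul, mul_assoc _ (h _) q]

theorem eq_zero_of_scalarOp_eq_zero {h : ℕ → ℂ[X]} {n : ℕ} (hh : ∀ p, scalarOp h n p = 0) :
    ∀ j ≤ n, h j = 0 := by
  intro j
  induction j using Nat.strong_induction_on with
  | _ j ih =>
    intro hj
    have hX := hh (X ^ j)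
    rw [scalarOp, Finset.sum_eq_single_of_mem j (by simpa using Nat.lt_succ_of_le hj)] at hX
    · simpa [iterate_derivative_X_pow_eq_C_mul, Nat.descFactorial_self, Nat.factorial_ne_zero]
        using hX
    · intro i _ hij
      rcases hij.lt_or_gt with hij | hij
      · rw [ih i hij (hij.le.trans hj), mul_zero]
      · rw [iterate_derivative_eq_zero (by simpa using hij), zero_mul]

theorem eq_zero_of_scalarOp_adjoint {c d : ℝ} (hcd : c ≠ d) {h : ℕ → ℂ[X]} {n : ℕ}
    (V : ℂ[X] → ℂ[X])
    (hV : ∀ p q, hermiteMoment c (scalarOp h n p * q) = hermiteMoment d (p * V q)) :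
    ∀ j ≤ n, h j = 0 := by
  obtain ⟨R, hR⟩ := exists_hermiteMoment_adjoint c h n
  have hR0 (q) : R q = 0 :=
    eq_zero_of_hermiteMoment_eq hcd (v := V q) fun p => by rw [← hR, hV]
  refine eq_zero_of_scalarOp_eq_zero fun p => eq_zero_of_forall_hermiteMoment_mul c fun q => ?_
  rw [mul_comm, hR, hR0, mul_zero, hermiteMoment_zero]

theorem mval_eq_map {N : ℕ} (P : (Mat N)[X]) (x : ℝ) :
    mval P x = (evalRingHom (x : ℂ)).mapMatrix (matPolyEquiv.symm P) := by
  rw [mval, smul_one_eq_diagonal]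
  exact (matPolyEquiv_symm_map_eval P (x : ℂ)).symm

theorem mval_apply {N : ℕ} (P : (Mat N)[X]) (x : ℝ) (s t : Fin N) :
    mval P x s t = (matPolyEquiv.symm P s t).eval (x : ℂ) := by
  rw [mval_eq_map]; rfl

theorem mval_mul {N : ℕ} (P Q : (Mat N)[X]) (x : ℝ) :
    mval (P * Q) x = mval P x * mval Q x := by
  simp only [mval_eq_map, map_mul]

theorem mval_one {N : ℕ} (x : ℝ) : mval (1 : (Mat N)[X]) x = 1 := by
  simp only [mval_eq_map, map_one]

theorem mval_one_add_X_mul_C {N : ℕ} (a : ℕ → ℝ) (x : ℝ) :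
    mval (1 + X * C (Amat N a)) x = Tmat N a x := by
  have h : mval (X * C (Amat N a)) x = (x : ℂ) • Amat N a := by
    rw [mval_mul, mval, mval, eval_X, eval_C, smul_one_mul]
  rw [mval, eval_add, ← mval, ← mval, mval_one, h, Tmat]

theorem mval_matPolyEquiv_single {N : ℕ} (i j : Fin N) (p : ℂ[X]) (x : ℝ) :
    mval (matPolyEquiv (single i j p)) x = single i j (p.eval (x : ℂ)) := by
  ext s t
  rw [mval_apply, AlgEquiv.symm_apply_apply, single_apply, single_apply]
  split_ifs <;> simp

theorem matPolyEquiv_symm_iterate_derivative {N : ℕ} (P : (Mat N)[X]) (j : ℕ) (s t : Fin N) :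
    matPolyEquiv.symm (derivative^[j] P) s t = derivative^[j] (matPolyEquiv.symm P s t) := by
  ext k
  simp [matPolyEquiv_symm_apply_coeff, coeff_iterate_derivative]

theorem matPolyEquiv_symm_applyOp_single {N : ℕ} (F : ℕ → (Mat N)[X]) (n : ℕ) (s i l : Fin N)
    (p : ℂ[X]) :
    matPolyEquiv.symm (applyOp F n (matPolyEquiv (single s i p))) s l
      = scalarOp (fun j => matPolyEquiv.symm (F j) i l) n p := by
  simp only [applyOp, scalarOp, map_sum, map_mul, Matrix.sum_apply]
  refine Finset.sum_congr rfl fun j _ => ?_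
  rw [Matrix.mul_apply, Finset.sum_eq_single i]
  · rw [matPolyEquiv_symm_iterate_derivative, AlgEquiv.symm_apply_apply, single_apply_same]
  · intro m _ hm
    rw [matPolyEquiv_symm_iterate_derivative, AlgEquiv.symm_apply_apply,
      single_apply_of_col_ne _ _ hm.symm, iterate_derivative_zero, zero_mul]
  · simp

/-- The off-diagonal entries of an operator symmetric for `hermiteDiag` vanish. -/
theorem isDiag_coeff_of_symmetric_hermiteDiag {N : ℕ} {b : ℕ → ℝ}
    (hb : ∀ i j, 1 ≤ i → i ≤ N → 1 ≤ j → j ≤ N → i ≠ j → b i ≠ b j)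
    {n : ℕ} {F : ℕ → (Mat N)[X]}
    (hsym : ∀ P Q : (Mat N)[X], ∀ s t : Fin N,
      ∫ x : ℝ, (mval (applyOp F n P) x * hermiteDiag N b x * (mval Q x)ᴴ) s t
        = ∫ x : ℝ, (mval P x * hermiteDiag N b x * (mval (applyOp F n Q) x)ᴴ) s t)
    {j : ℕ} (hj : j ≤ n) (k : ℕ) : ((F j).coeff k).IsDiag := by
  intro s t hst
  have hne : b ((t : ℕ) + 1) ≠ b ((s : ℕ) + 1) :=
    hb _ _ (by omega) (by omega) (by omega) (by omega) fun h => hst (Fin.ext (by omega))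
  have key := eq_zero_of_scalarOp_adjoint hne (h := fun j => matPolyEquiv.symm (F j) s t) (n := n)
    (fun q => conjPoly (scalarOp (fun j => matPolyEquiv.symm (F j) t s) n (conjPoly q)))
    (fun p q => by
      have h := hsym (matPolyEquiv (single s s p)) (matPolyEquiv (single s t (conjPoly q))) s s
      simp only [mval_matPolyEquiv_single, conjTranspose_single, mul_single_apply_same,
        hermiteDiag, mul_diagonal, Matrix.mul_assoc, single_mul_apply_same, diagonal_mul,
        conjTranspose_apply, mval_apply, matPolyEquiv_symm_applyOp_single,
        ← eval_conjPoly, conjPoly_conjPoly] at h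
      simp only [hermiteMoment, eval_mul]
      convert h using 3 <;> ring) j hj
  rw [← matPolyEquiv_symm_apply_coeff]
  simp [key]

theorem Amat_apply_eq_zero {N : ℕ} (a : ℕ → ℝ) {p q : Fin N}
    (h : ¬(Even (p : ℕ) ∧ Odd (q : ℕ))) : Amat N a p q = 0 := by
  rw [Nat.even_iff, Nat.odd_iff] at h
  simp only [Amat, Matrix.add_apply, Matrix.sum_apply, Matrix.smul_apply, EU, of_apply]
  rw [Finset.sum_eq_zero, Finset.sum_eq_zero, add_zero]
  all_goals
    intro j hj
    rw [Finset.mem_Icc] at hj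
    rw [if_neg (by omega), smul_zero]

theorem Amat_mul_isDiag_mul_Amat {N : ℕ} (a : ℕ → ℝ) {D : Mat N} (hD : D.IsDiag) :
    Amat N a * D * Amat N a = 0 := by
  ext p q
  rw [← hD.diagonal_diag, Matrix.mul_apply, Matrix.zero_apply]
  refine Finset.sum_eq_zero fun l _ => ?_
  rw [mul_diagonal]
  rcases Nat.even_or_odd (l : ℕ) with hl | hl
  · rw [Amat_apply_eq_zero a fun h => Nat.not_odd_iff_even.2 hl h.2, zero_mul, zero_mul]
  · rw [Amat_apply_eq_zero a (p := l) fun h => Nat.not_odd_iff_even.2 h.1 hl, mul_zero]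

theorem Amat_mul_self (N : ℕ) (a : ℕ → ℝ) : Amat N a * Amat N a = 0 := by
  simpa using Amat_mul_isDiag_mul_Amat a (D := (1 : Mat N)) isDiag_one

theorem Amat_mul_isDiag_apply_self {N : ℕ} (a : ℕ → ℝ) {D : Mat N} (hD : D.IsDiag) (i : Fin N) :
    (Amat N a * D) i i = 0 := by
  rw [← hD.diagonal_diag, mul_diagonal, Amat_apply_eq_zero, zero_mul]
  exact fun h => Nat.not_odd_iff_even.2 h.1 h.2

theorem isDiag_mul_Amat_apply_self {N : ℕ} (a : ℕ → ℝ) {D : Mat N} (hD : D.IsDiag) (i : Fin N) :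
    (D * Amat N a) i i = 0 := by
  rw [← hD.diagonal_diag, diagonal_mul, Amat_apply_eq_zero, mul_zero]
  exact fun h => Nat.not_odd_iff_even.2 h.1 h.2

theorem C_mul_mul_C_eq_zero {N : ℕ} (a : ℕ → ℝ) {F : (Mat N)[X]}
    (hF : ∀ k, (F.coeff k).IsDiag) : C (Amat N a) * F * C (Amat N a) = 0 := by
  ext1 k
  rw [coeff_mul_C, coeff_C_mul, Amat_mul_isDiag_mul_Amat a (hF k), coeff_zero]

section Conjugation

variable {R : Type*} [Ring R] {B : R}

theorem mul_X_mul_C (P : R[X]) : P * (X * C B) = X * (P * C B) := by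
  rw [← mul_assoc, ← X_mul, mul_assoc]

theorem one_add_X_mul_C_mul_one_sub (hB : B * B = 0) :
    (1 + X * C B) * (1 - X * C B) = 1 := by
  have h : X * C B * (X * C B) = 0 := by
    rw [mul_X_mul_C, mul_assoc, ← C_mul, hB, C_0, mul_zero, mul_zero]
  rw [add_mul, mul_sub, mul_sub, h]
  simp

theorem one_sub_X_mul_C_mul_one_add (hB : B * B = 0) :
    (1 - X * C B) * (1 + X * C B) = 1 := by
  have h : X * C B * (X * C B) = 0 := by
    rw [mul_X_mul_C, mul_assoc, ← C_mul, hB, C_0, mul_zero, mul_zero]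
  rw [sub_mul, mul_add, mul_add, h]
  simp

theorem one_add_X_mul_C_conj {F : R[X]} (hF : C B * F * C B = 0) :
    (1 + X * C B) * F * (1 - X * C B) = F + X * (C B * F - F * C B) := by
  have h : X * C B * F * (X * C B) = 0 := by
    rw [mul_X_mul_C, mul_assoc X, mul_assoc X, hF, mul_zero, mul_zero]
  rw [add_mul, mul_sub, add_mul _ _ (X * C B), h, one_mul, mul_X_mul_C, mul_one, mul_sub,
    add_zero, mul_assoc X]
  abel

/-- The coefficients of the operator `P ↦ (P (1 - xB)) · 𝔇 (1 + xB)`, where `𝔇` has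
coefficients `G`. -/
def conjCoeff (B : R) (G : ℕ → R[X]) (j : ℕ) : R[X] :=
  (1 - X * C B) * G j * (1 + X * C B) - (j + 1) • (C B * G (j + 1) * (1 + X * C B))

theorem conjCoeff_inverse (hB : B * B = 0) (G : ℕ → R[X]) (j : ℕ) :
    (1 + X * C B) * conjCoeff B G j * (1 - X * C B)
      + (j + 1) • (C B * conjCoeff B G (j + 1) * (1 - X * C B)) = G j := by
  have hTS := one_add_X_mul_C_mul_one_sub hB
  have hCC : C B * C B = 0 := by rw [← C_mul, hB, C_0]
  have hTC : (1 + X * C B) * C B = C B := by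
    rw [add_mul, mul_assoc, hCC]; simp
  have hCS : C B * (1 - X * C B) = C B := by
    rw [mul_sub, mul_X_mul_C, hCC]; simp
  simp only [conjCoeff]
  generalize 1 + X * C B = T at *
  generalize 1 - X * C B = S at *
  have h1 : T * (S * G j * T - (j + 1) • (C B * G (j + 1) * T)) * S
      = G j - (j + 1) • (C B * G (j + 1)) := by
    rw [mul_sub, sub_mul, mul_smul_comm, smul_mul_assoc]
    congr 2
    · rw [mul_assoc S, ← mul_assoc, hTS, one_mul, mul_assoc, hTS, mul_one]
    · rw [mul_assoc (C B), ← mul_assoc, hTC, mul_assoc, mul_assoc, hTS, mul_one]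
  have h2 : C B * (S * G (j + 1) * T - (j + 1 + 1) • (C B * G (j + 1 + 1) * T)) * S
      = C B * G (j + 1) := by
    rw [mul_sub, sub_mul, mul_smul_comm, smul_mul_assoc, mul_assoc (C B) (G _),
      ← mul_assoc (C B) (C B), hCC, zero_mul, zero_mul, smul_zero, sub_zero, mul_assoc S,
      ← mul_assoc (C B), hCS, mul_assoc, mul_assoc, hTS, mul_one]
  rw [h1, h2, sub_add_cancel]

theorem iterate_derivative_mul_one_sub (P : R[X]) (j : ℕ) :
    derivative^[j] (P * (1 - X * C B))
      = derivative^[j] P * (1 - X * C B) - j • (derivative^[j - 1] P * C B) := by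
  induction j with
  | zero => simp
  | succ j ih =>
    have h : derivative (j • (derivative^[j - 1] P * C B)) = j • (derivative^[j] P * C B) := by
      cases j with
      | zero => simp
      | succ j => simp [Function.iterate_succ_apply']
    rw [Function.iterate_succ_apply', ih, derivative_sub, h, derivative_mul,
      Function.iterate_succ_apply', add_tsub_cancel_right, succ_nsmul]
    simp
    abel

end Conjugation

theorem applyOp_conjCoeff {N : ℕ} (B : Mat N) {G : ℕ → (Mat N)[X]} {n : ℕ} (hG : G (n + 1) = 0)
    (P : (Mat N)[X]) :
    applyOp (conjCoeff B G) n P = applyOp G n (P * (1 - X * C B)) * (1 + X * C B) := by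
  have hshift : ∑ j ∈ Finset.range (n + 1),
        j • (derivative^[j - 1] P * C B * G j * (1 + X * C B))
      = ∑ j ∈ Finset.range (n + 1),
        (j + 1) • (derivative^[j] P * C B * G (j + 1) * (1 + X * C B)) := by
    rw [Finset.sum_range_succ', Finset.sum_range_succ _ n]
    simp [hG]
  have hl : applyOp (conjCoeff B G) n P = ∑ j ∈ Finset.range (n + 1),
      (derivative^[j] P * (1 - X * C B) * G j * (1 + X * C B)
        - (j + 1) • (derivative^[j] P * C B * G (j + 1) * (1 + X * C B))) := by
    refine Finset.sum_congr rfl fun j _ => ?_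
    simp only [conjCoeff]
    generalize 1 + X * C B = T
    generalize 1 - X * C B = S
    simp only [mul_sub, mul_smul_comm, mul_assoc]
  have hr : applyOp G n (P * (1 - X * C B)) * (1 + X * C B) = ∑ j ∈ Finset.range (n + 1),
      (derivative^[j] P * (1 - X * C B) * G j * (1 + X * C B)
        - j • (derivative^[j - 1] P * C B * G j * (1 + X * C B))) := by
    rw [applyOp, Finset.sum_mul]
    refine Finset.sum_congr rfl fun j _ => ?_
    rw [iterate_derivative_mul_one_sub]
    generalize 1 + X * C B = T
    generalize 1 - X * C B = S
    simp only [sub_mul, smul_mul_assoc]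
  rw [hl, hr, Finset.sum_sub_distrib, Finset.sum_sub_distrib, hshift]

/-- every `W_H`-symmetric differential operator with coefficients `G_j` of degree
`≤ j` is the conjugate by `T(x)` of a `W̃_H`-symmetric operator with diagonal coefficients
`F_j` of degree `≤ j`, via `G_n = F_n + x[A,F_n]` and
`G_j = F_j + x[A,F_j] + (j+1)A F_{j+1}` for `j < n`. -/
theorem stmt12 (N : ℕ) (hN : 2 ≤ N) (a : ℕ → ℝ)
    (ha : ∀ j, 1 ≤ j → j ≤ N - 1 → a j ≠ 0)
    (b : ℕ → ℝ)
    (hb : ∀ i j, 1 ≤ i → i ≤ N → 1 ≤ j → j ≤ N → i ≠ j → b i ≠ b j)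
    (n : ℕ) (G : ℕ → Polynomial (Mat N))
    (hGdeg : ∀ j, j ≤ n → (G j).degree ≤ (j : ℕ))
    (hsym : ∀ P Q : Polynomial (Mat N), ∀ s t : Fin N,
      ∫ x : ℝ, (mval (applyOp G n P) x * WH N a b x * (mval Q x)ᴴ) s t
        = ∫ x : ℝ, (mval P x * WH N a b x * (mval (applyOp G n Q) x)ᴴ) s t) :
    ∃ F : ℕ → Polynomial (Mat N),
      (∀ j, j ≤ n → (∀ k, ((F j).coeff k).IsDiag) ∧ (F j).degree ≤ (j : ℕ)) ∧
      G n = F n + Polynomial.X *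
          (Polynomial.C (Amat N a) * F n - F n * Polynomial.C (Amat N a)) ∧
      (∀ j, j < n → G j = F j + Polynomial.X *
          (Polynomial.C (Amat N a) * F j - F j * Polynomial.C (Amat N a))
          + (j + 1) • (Polynomial.C (Amat N a) * F (j + 1))) ∧
      (∀ P Q : Polynomial (Mat N), ∀ s t : Fin N,
        ∫ x : ℝ, (mval (applyOp F n P) x * hermiteDiag N b x * (mval Q x)ᴴ) s t
          = ∫ x : ℝ, (mval P x * hermiteDiag N b x * (mval (applyOp F n Q) x)ᴴ) s t) := by
  set A := Amat N a with hA
  set G' : ℕ → (Mat N)[X] := fun j => if j ≤ n then G j else 0 with hG'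
  have hG'_of_le {j : ℕ} (hj : j ≤ n) : G' j = G j := if_pos hj
  have hG'_of_lt {j : ℕ} (hj : n < j) : G' j = 0 := if_neg hj.not_ge
  have happly (P : (Mat N)[X]) : applyOp G' n P = applyOp G n P :=
    Finset.sum_congr rfl fun j hj => by
      rw [hG'_of_le (Nat.lt_succ_iff.1 (Finset.mem_range.1 hj))]
  have hAA : A * A = 0 := Amat_mul_self N a
  set F := conjCoeff A G' with hF
  have hFsym (P Q : (Mat N)[X]) (s t : Fin N) :
      ∫ x : ℝ, (mval (applyOp F n P) x * hermiteDiag N b x * (mval Q x)ᴴ) s t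
        = ∫ x : ℝ, (mval P x * hermiteDiag N b x * (mval (applyOp F n Q) x)ᴴ) s t := by
    have hST (R : (Mat N)[X]) (x : ℝ) : mval (R * (1 - X * C A)) x * Tmat N a x = mval R x := by
      rw [← mval_one_add_X_mul_C, ← mval_mul, mul_assoc, one_sub_X_mul_C_mul_one_add hAA, mul_one]
    have happlyF (R : (Mat N)[X]) (x : ℝ) : mval (applyOp F n R) x
        = mval (applyOp G n (R * (1 - X * C A))) x * Tmat N a x := by
      rw [applyOp_conjCoeff A (hG'_of_lt n.lt_succ_self), happly, mval_mul, mval_one_add_X_mul_C]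
    have h := hsym (P * (1 - X * C A)) (Q * (1 - X * C A)) s t
    have hW (U V : Mat N) (x : ℝ) : U * WH N a b x * Vᴴ
        = U * Tmat N a x * hermiteDiag N b x * (V * Tmat N a x)ᴴ := by
      rw [WH, conjTranspose_mul]
      simp only [Matrix.mul_assoc]
    simpa only [hW, hST, ← happlyF] using h
  have hdiag (j : ℕ) (k : ℕ) : ((F j).coeff k).IsDiag := by
    rcases le_or_gt j n with hj | hj
    · exact isDiag_coeff_of_symmetric_hermiteDiag hb hFsym hj k
    · rw [hF, conjCoeff, hG'_of_lt hj, hG'_of_lt (hj.trans j.lt_succ_self)]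
      simp
  have hG (j : ℕ) : G' j = F j + X * (C A * F j - F j * C A) + (j + 1) • (C A * F (j + 1)) := by
    have hC := C_mul_mul_C_eq_zero a (hdiag (j + 1))
    rw [← conjCoeff_inverse hAA G' j, one_add_X_mul_C_conj (C_mul_mul_C_eq_zero a (hdiag j)),
      mul_sub (C A * conjCoeff A G' (j + 1)), mul_X_mul_C, hC, mul_zero, mul_one, sub_zero]
  have hFn : F (n + 1) = 0 := by
    rw [hF, conjCoeff, hG'_of_lt n.lt_succ_self, hG'_of_lt (by omega)]
    simp
  refine ⟨F, fun j hj => ⟨hdiag j, ?_⟩, ?_, fun j hj => ?_, hFsym⟩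
  · rw [degree_le_iff_coeff_zero]
    intro k hk
    have hGk : (G j).coeff k = 0 := coeff_eq_zero_of_degree_lt ((hGdeg j hj).trans_lt hk)
    rw [← (hdiag j k).diagonal_diag]
    refine diagonal_eq_zero.2 (funext fun i => ?_)
    rw [← hG'_of_le hj, hG] at hGk
    have hi := congrFun (congrFun hGk i) i
    have hX : (X * (C A * F j - F j * C A)).coeff k i i = 0 := by
      cases k with
      | zero => simp
      | succ k =>
        rw [coeff_X_mul, coeff_sub, coeff_C_mul, coeff_mul_C, Matrix.sub_apply,
          Amat_mul_isDiag_apply_self a (hdiag j k), isDiag_mul_Amat_apply_self a (hdiag j k),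
          sub_zero]
    rwa [coeff_add, coeff_add, coeff_smul, coeff_C_mul, Matrix.add_apply, Matrix.add_apply, hX,
      Matrix.smul_apply, Amat_mul_isDiag_apply_self a (hdiag (j + 1) k), smul_zero, add_zero,
      add_zero] at hi
  · rw [← hG'_of_le le_rfl, hG, hFn, mul_zero, smul_zero, add_zero]
  · rw [← hG'_of_le hj.le, hG]
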